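/- Let p = q = ∞ and 0 < v ≤ u ≤ ∞. Then there exist constants c, C > 0 depending only on u, v such that for all n ∈ ℕ and all k ∈ ℕ: c · 2^{−k/n} (log(n+1))^{1/v − 1/u} ≤ e_k(id: ℓ_{∞,u}^n → ℓ_{∞,v}^n) ≤ C · 2^{−k/n} (log(n+1))^{1/v − 1/u}. -/

import Mathlib

open scoped ENNReal Classical
open MeasureTheory

/-- The non-increasing rearrangement of `x : ℝ^n`: for `1 ≤ i ≤ n`,
`rearr n x i` is the `i`-th largest of the absolute values of the entries of `x`,
defined via `x_i^* = inf {t ≥ 0 : #{j : |x j| > t} ≤ i - 1}`. -/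
noncomputable def rearr (n : ℕ) (x : Fin n → ℝ) (i : ℕ) : ℝ :=
  sInf {t : ℝ | 0 ≤ t ∧ ((Finset.univ : Finset (Fin n)).filter (fun j => t < |x j|)).card ≤ i - 1}

/-- The Lorentz quasi-norm `‖x‖_{p,u}` on `ℝ^n` for `p, u ∈ (0,∞]`, with the
convention `1/∞ = 0`:  `‖x‖_{p,u} = (∑_{i=1}^n i^{u/p-1} (x_i^*)^u)^{1/u}` for `u < ∞`
and `‖x‖_{p,∞} = max_{1 ≤ i ≤ n} i^{1/p} x_i^*`. -/
noncomputable def lorentzNorm (n : ℕ) (p u : ℝ≥0∞) (x : Fin n → ℝ) : ℝ :=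
  if u = ⊤ then
    sSup {t : ℝ | ∃ i ∈ Finset.Icc 1 n, t = (i : ℝ) ^ (1 / p).toReal * rearr n x i}
  else
    (∑ i ∈ Finset.Icc 1 n, (i : ℝ) ^ ((u / p).toReal - 1) * rearr n x i ^ u.toReal) ^ (1 / u.toReal)

/-- The `k`-th (dyadic) entropy number of the identity map from `(ℝ^n, NX)` to `(ℝ^n, NY)`:
`e_k = inf {ε > 0 : ∃ y_1, …, y_{2^{k-1}} with B_X ⊆ ⋃ (y_i + ε B_Y)}`. -/
noncomputable def entropyNumber (n : ℕ) (NX NY : (Fin n → ℝ) → ℝ) (k : ℕ) : ℝ :=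
  sInf {ε : ℝ | 0 < ε ∧ ∃ T : Finset (Fin n → ℝ), T.card ≤ 2 ^ (k - 1) ∧
    ∀ x : Fin n → ℝ, NX x ≤ 1 → ∃ y ∈ T, NY (x - y) ≤ ε}

/-- The operator norm of the identity map from `(ℝ^n, NX)` to `(ℝ^n, NY)`:
`‖id‖ = sup {NY x : NX x ≤ 1}`. -/
noncomputable def opNorm (n : ℕ) (NX NY : (Fin n → ℝ) → ℝ) : ℝ :=
  sSup {t : ℝ | ∃ x : Fin n → ℝ, NX x ≤ 1 ∧ t = NY x}

theorem rearr_nonneg (n : ℕ) (x : Fin n → ℝ) (i : ℕ) : 0 ≤ rearr n x i :=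
  Real.sInf_nonneg fun _ ht => ht.1

theorem rearr_bddBelow (n : ℕ) (x : Fin n → ℝ) (i : ℕ) :
    BddBelow {t : ℝ | 0 ≤ t ∧
      ((Finset.univ : Finset (Fin n)).filter (fun j => t < |x j|)).card ≤ i - 1} :=
  ⟨0, fun _ ht => ht.1⟩

theorem mem_rearr_set_of_forall_le {n : ℕ} {x : Fin n → ℝ} {t : ℝ} (ht : 0 ≤ t)
    (hx : ∀ j, |x j| ≤ t) (i : ℕ) :
    t ∈ {t : ℝ | 0 ≤ t ∧
      ((Finset.univ : Finset (Fin n)).filter (fun j => t < |x j|)).card ≤ i - 1} := by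
  refine ⟨ht, ?_⟩
  rw [Finset.filter_false_of_mem fun j _ => not_lt.2 (hx j)]
  simp

theorem rearr_le_of_forall_le {n : ℕ} {x : Fin n → ℝ} {t : ℝ} (ht : 0 ≤ t)
    (hx : ∀ j, |x j| ≤ t) (i : ℕ) : rearr n x i ≤ t :=
  csInf_le (rearr_bddBelow n x i) (mem_rearr_set_of_forall_le ht hx i)

theorem rearr_set_nonempty (n : ℕ) (x : Fin n → ℝ) (i : ℕ) :
    {t : ℝ | 0 ≤ t ∧
      ((Finset.univ : Finset (Fin n)).filter (fun j => t < |x j|)).card ≤ i - 1}.Nonempty :=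
  ⟨∑ j, |x j|, mem_rearr_set_of_forall_le (Finset.sum_nonneg fun _ _ => abs_nonneg _)
    (fun j => Finset.single_le_sum (f := fun j => |x j|) (fun _ _ => abs_nonneg _)
      (Finset.mem_univ j)) i⟩

theorem rearr_antitone (n : ℕ) (x : Fin n → ℝ) : Antitone (rearr n x) := fun i m him =>
  csInf_le_csInf (rearr_bddBelow n x m) (rearr_set_nonempty n x i)
    fun _ ht => ⟨ht.1, ht.2.trans (Nat.sub_le_sub_right him 1)⟩

theorem card_lt_abs_le_of_rearr_lt {n : ℕ} {x : Fin n → ℝ} {i : ℕ} {t : ℝ}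
    (h : rearr n x i < t) :
    ((Finset.univ : Finset (Fin n)).filter (fun j => t < |x j|)).card ≤ i - 1 := by
  obtain ⟨t', ht', hlt⟩ := exists_lt_of_csInf_lt (rearr_set_nonempty n x i) h
  refine le_trans (Finset.card_le_card ?_) ht'.2
  intro j
  simp only [Finset.mem_filter, Finset.mem_univ, true_and]
  exact hlt.trans

theorem abs_le_of_rearr_one_lt {n : ℕ} {x : Fin n → ℝ} {t : ℝ} (h : rearr n x 1 < t)
    (j : Fin n) : |x j| ≤ t := by
  have hcard := card_lt_abs_le_of_rearr_lt h
  rw [Nat.sub_self, Nat.le_zero, Finset.card_eq_zero, Finset.filter_eq_empty_iff] at hcard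
  exact not_lt.1 (hcard (Finset.mem_univ j))

theorem lorentzNorm_top_top {n : ℕ} (hn : 0 < n) (x : Fin n → ℝ) :
    lorentzNorm n ⊤ ⊤ x = rearr n x 1 := by
  rw [lorentzNorm, if_pos rfl]
  refine IsGreatest.csSup_eq ⟨⟨1, Finset.mem_Icc.2 ⟨le_rfl, hn⟩, by simp⟩, ?_⟩
  rintro t ⟨i, hi, rfl⟩
  simpa using rearr_antitone n x (Finset.mem_Icc.1 hi).1

theorem lorentzNorm_top_of_ne_top {n : ℕ} {u : ℝ≥0∞} (hu : u ≠ ⊤) (x : Fin n → ℝ) :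
    lorentzNorm n ⊤ u x =
      (∑ i ∈ Finset.Icc 1 n, (i : ℝ)⁻¹ * rearr n x i ^ u.toReal) ^ (1 / u.toReal) := by
  rw [lorentzNorm, if_neg hu]
  simp [Real.rpow_neg_one]

theorem sum_Icc_inv_eq_harmonic (n : ℕ) :
    ∑ i ∈ Finset.Icc 1 n, (i : ℝ)⁻¹ = (harmonic n : ℝ) := by
  rw [harmonic_eq_sum_Icc]
  push_cast
  rfl

theorem log_two_le_log_add_one {n : ℕ} (hn : 0 < n) : 1 / 2 ≤ Real.log ((n : ℝ) + 1) := by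
  have h1 : (1 : ℝ) ≤ n := by exact_mod_cast hn
  have h2 : Real.log 2 ≤ Real.log ((n : ℝ) + 1) := Real.log_le_log (by norm_num) (by linarith)
  linarith [Real.log_two_gt_d9]

theorem harmonic_le_three_mul_log {n : ℕ} (hn : 0 < n) :
    (harmonic n : ℝ) ≤ 3 * Real.log ((n : ℝ) + 1) := by
  have h1 : (1 : ℝ) ≤ n := by exact_mod_cast hn
  have h2 : Real.log n ≤ Real.log ((n : ℝ) + 1) := Real.log_le_log (by linarith) (by linarith)
  linarith [harmonic_le_one_add_log n, log_two_le_log_add_one hn]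

theorem log_add_one_le_harmonic_cast (n : ℕ) :
    Real.log ((n : ℝ) + 1) ≤ (harmonic n : ℝ) := by
  exact_mod_cast log_add_one_le_harmonic n

theorem toReal_one_div_le_one_div {u v : ℝ≥0∞} (hv : 0 < v) (hvu : v ≤ u) :
    (1 / u).toReal ≤ (1 / v).toReal :=
  ENNReal.toReal_mono (by simp [hv.ne']) (ENNReal.div_le_div_left hvu 1)

/-- The weak-type bound on the rearrangement of a vector in the ball of `ℓ_{∞,u}^n`. -/
theorem rearr_mul_harmonic_rpow_le {n m : ℕ} {u : ℝ≥0∞} (hu : 0 < u) (hm : 0 < m) (hmn : m ≤ n)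
    (x : Fin n → ℝ) :
    rearr n x m * (harmonic m : ℝ) ^ (1 / u).toReal ≤ lorentzNorm n ⊤ u x := by
  have hx := rearr_nonneg n x
  rcases eq_or_ne u ⊤ with rfl | hut
  · rw [lorentzNorm_top_top (hm.trans_le hmn)]
    simpa using rearr_antitone n x hm
  have hupos : 0 < u.toReal := ENNReal.toReal_pos hu.ne' hut
  rw [lorentzNorm_top_of_ne_top hut, ENNReal.toReal_div, ENNReal.toReal_one]
  have hH : (0 : ℝ) ≤ harmonic m := by
    rw [← sum_Icc_inv_eq_harmonic]; positivity
  have key : (rearr n x m) ^ u.toReal * harmonic m ≤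
      ∑ i ∈ Finset.Icc 1 n, (i : ℝ)⁻¹ * rearr n x i ^ u.toReal := by
    calc (rearr n x m) ^ u.toReal * harmonic m
        = ∑ i ∈ Finset.Icc 1 m, (i : ℝ)⁻¹ * rearr n x m ^ u.toReal := by
          rw [← sum_Icc_inv_eq_harmonic, ← Finset.sum_mul, mul_comm]
      _ ≤ ∑ i ∈ Finset.Icc 1 m, (i : ℝ)⁻¹ * rearr n x i ^ u.toReal := by
          refine Finset.sum_le_sum fun i hi => ?_
          have := Real.rpow_le_rpow (hx m) (rearr_antitone n x (Finset.mem_Icc.1 hi).2) hupos.le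
          gcongr
      _ ≤ _ := by
          refine Finset.sum_le_sum_of_subset_of_nonneg (Finset.Icc_subset_Icc_right hmn) ?_
          intro i _ _
          have := Real.rpow_nonneg (hx i) u.toReal
          positivity
  calc rearr n x m * (harmonic m : ℝ) ^ (1 / u.toReal)
      = ((rearr n x m) ^ u.toReal * harmonic m) ^ (1 / u.toReal) := by
        rw [Real.mul_rpow (Real.rpow_nonneg (hx m) _) hH, ← Real.rpow_mul (hx m),
          mul_one_div_cancel hupos.ne', Real.rpow_one]
    _ ≤ _ := Real.rpow_le_rpow (mul_nonneg (Real.rpow_nonneg (hx m) _) hH) key (by positivity)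

theorem lorentzNorm_top_le_of_forall_le {n : ℕ} {u : ℝ≥0∞} (hn : 0 < n) (hu : 0 < u)
    {x : Fin n → ℝ} {t : ℝ} (ht : 0 ≤ t) (hx : ∀ j, |x j| ≤ t) :
    lorentzNorm n ⊤ u x ≤ t * (harmonic n : ℝ) ^ (1 / u).toReal := by
  rcases eq_or_ne u ⊤ with rfl | hut
  · rw [lorentzNorm_top_top hn]
    simpa using rearr_le_of_forall_le ht hx 1
  have hupos : 0 < u.toReal := ENNReal.toReal_pos hu.ne' hut
  rw [lorentzNorm_top_of_ne_top hut, ENNReal.toReal_div, ENNReal.toReal_one]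
  have hH : (0 : ℝ) ≤ harmonic n := by
    rw [← sum_Icc_inv_eq_harmonic]; positivity
  have key : ∑ i ∈ Finset.Icc 1 n, (i : ℝ)⁻¹ * rearr n x i ^ u.toReal ≤
      t ^ u.toReal * harmonic n := by
    rw [← sum_Icc_inv_eq_harmonic, mul_comm, Finset.sum_mul]
    refine Finset.sum_le_sum fun i _ => ?_
    have := Real.rpow_le_rpow (rearr_nonneg n x i) (rearr_le_of_forall_le ht hx i) hupos.le
    gcongr
  calc _ ≤ (t ^ u.toReal * harmonic n) ^ (1 / u.toReal) := by
        refine Real.rpow_le_rpow (Finset.sum_nonneg fun i _ => ?_) key (by positivity)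
        have := Real.rpow_nonneg (rearr_nonneg n x i) u.toReal
        positivity
    _ = _ := by
        rw [Real.mul_rpow (Real.rpow_nonneg ht _) hH, ← Real.rpow_mul ht,
          mul_one_div_cancel hupos.ne', Real.rpow_one]

/-- Hölder's inequality for the embedding `ℓ_{∞,u}^n → ℓ_{∞,v}^n`. -/
theorem lorentzNorm_top_le_harmonic_rpow {n : ℕ} {u v : ℝ≥0∞} (hn : 0 < n) (hv : 0 < v)
    (hvu : v ≤ u) {x : Fin n → ℝ} (hx : lorentzNorm n ⊤ u x ≤ 1) :
    lorentzNorm n ⊤ v x ≤ (harmonic n : ℝ) ^ ((1 / v).toReal - (1 / u).toReal) := by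
  have hr := rearr_nonneg n x
  rcases eq_or_ne v ⊤ with rfl | hvt
  · obtain rfl : u = ⊤ := top_le_iff.1 hvu
    simpa using hx
  have hvpos : 0 < v.toReal := ENNReal.toReal_pos hv.ne' hvt
  have hH : (0 : ℝ) < harmonic n := by exact_mod_cast harmonic_pos hn.ne'
  rw [lorentzNorm_top_of_ne_top hvt]
  have hS0 : 0 ≤ ∑ i ∈ Finset.Icc 1 n, (i : ℝ)⁻¹ * rearr n x i ^ v.toReal :=
    Finset.sum_nonneg fun i _ => mul_nonneg (by positivity) (Real.rpow_nonneg (hr i) _)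
  suffices hS : ∑ i ∈ Finset.Icc 1 n, (i : ℝ)⁻¹ * rearr n x i ^ v.toReal ≤
      (harmonic n : ℝ) ^ (1 - v.toReal * (1 / u).toReal) by
    calc _ ≤ ((harmonic n : ℝ) ^ (1 - v.toReal * (1 / u).toReal)) ^ (1 / v.toReal) :=
          Real.rpow_le_rpow hS0 hS (by positivity)
      _ = _ := by
          rw [← Real.rpow_mul hH.le, ENNReal.toReal_div 1 v, ENNReal.toReal_one]
          congr 1
          field_simp
  rcases eq_or_ne u ⊤ with rfl | hut
  · rw [lorentzNorm_top_top hn] at hx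
    simp only [ENNReal.div_top, ENNReal.toReal_zero, mul_zero, sub_zero, Real.rpow_one]
    rw [← sum_Icc_inv_eq_harmonic]
    refine Finset.sum_le_sum fun i hi => mul_le_of_le_one_right (by positivity) ?_
    exact Real.rpow_le_one (hr i)
      ((rearr_antitone n x (Finset.mem_Icc.1 hi).1).trans hx) hvpos.le
  have hu : 0 < u := hv.trans_le hvu
  have hupos : 0 < u.toReal := ENNReal.toReal_pos hu.ne' hut
  have hvu' : v.toReal ≤ u.toReal := ENNReal.toReal_mono hut hvu
  rw [lorentzNorm_top_of_ne_top hut] at hx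
  have hU0 : 0 ≤ ∑ i ∈ Finset.Icc 1 n, (i : ℝ)⁻¹ * rearr n x i ^ u.toReal :=
    Finset.sum_nonneg fun i _ => mul_nonneg (by positivity) (Real.rpow_nonneg (hr i) _)
  have hU : ∑ i ∈ Finset.Icc 1 n, (i : ℝ)⁻¹ * rearr n x i ^ u.toReal ≤ 1 := by
    by_contra! hcon
    exact absurd hx (not_le.2 (Real.one_lt_rpow hcon (by positivity)))
  have hmean := Real.rpow_arith_mean_le_arith_mean_rpow (Finset.Icc 1 n)
    (fun i => (i : ℝ)⁻¹ / harmonic n) (fun i => rearr n x i ^ v.toReal)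
    (fun i _ => by positivity)
    (by rw [← Finset.sum_div, sum_Icc_inv_eq_harmonic, div_self hH.ne'])
    (fun i _ => Real.rpow_nonneg (hr i) _) ((one_le_div hvpos).2 hvu')
  have e1 : ∑ i ∈ Finset.Icc 1 n, (i : ℝ)⁻¹ / harmonic n * rearr n x i ^ v.toReal =
      (∑ i ∈ Finset.Icc 1 n, (i : ℝ)⁻¹ * rearr n x i ^ v.toReal) / harmonic n := by
    rw [Finset.sum_div]
    exact Finset.sum_congr rfl fun i _ => by ring
  have e2 : ∑ i ∈ Finset.Icc 1 n,
        (i : ℝ)⁻¹ / harmonic n * (rearr n x i ^ v.toReal) ^ (u.toReal / v.toReal) =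
      (∑ i ∈ Finset.Icc 1 n, (i : ℝ)⁻¹ * rearr n x i ^ u.toReal) / harmonic n := by
    rw [Finset.sum_div]
    refine Finset.sum_congr rfl fun i _ => ?_
    rw [← Real.rpow_mul (hr i), mul_div_cancel₀ _ hvpos.ne']
    ring
  rw [e1, e2] at hmean
  set S := ∑ i ∈ Finset.Icc 1 n, (i : ℝ)⁻¹ * rearr n x i ^ v.toReal
  have h1 : (S / harmonic n) ^ (u.toReal / v.toReal) ≤ (harmonic n : ℝ)⁻¹ :=
    hmean.trans (by rw [inv_eq_one_div]; gcongr)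
  have h2 : S / harmonic n ≤ ((harmonic n : ℝ)⁻¹) ^ (v.toReal / u.toReal) := by
    have h3 := Real.rpow_le_rpow (by positivity) h1 (div_pos hvpos hupos).le
    rwa [← Real.rpow_mul (by positivity), div_mul_div_cancel₀ hvpos.ne', div_self hupos.ne',
      Real.rpow_one] at h3
  rw [div_le_iff₀ hH] at h2
  refine h2.trans (le_of_eq ?_)
  rw [Real.rpow_sub hH, Real.rpow_one, Real.inv_rpow hH.le, ENNReal.toReal_div,
    ENNReal.toReal_one, mul_one_div]
  field_simp

/-- Vectors with few large entries admit an economical grid covering in the sup norm. -/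
theorem exists_grid_cover (n s M N : ℕ) {P R h : ℝ} (hh : 0 < h) (hR : 1 ≤ R)
    (hM : 2 * (M : ℝ) + 1 ≤ P) (hN : 2 * (N : ℝ) + 1 ≤ P * R) :
    ∃ T : Finset (Fin n → ℝ), (T.card : ℝ) ≤ 2 ^ n * P ^ n * R ^ s ∧
      ∀ x : Fin n → ℝ, (∀ j, |x j| ≤ N * h) →
        ((Finset.univ : Finset (Fin n)).filter (fun j => M * h < |x j|)).card ≤ s →
        ∃ y ∈ T, ∀ j, |x j - y j| ≤ h := by
  have hP : 0 ≤ P := le_trans (by positivity) hM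
  let box (S : Finset (Fin n)) : Finset (Fin n → ℤ) :=
    Fintype.piFinset fun j => if j ∈ S then Finset.Icc (-(N : ℤ)) N else Finset.Icc (-(M : ℤ)) M
  let family : Finset (Finset (Fin n)) := Finset.univ.filter fun S => S.card ≤ s
  refine ⟨(family.biUnion box).image fun z j => (z j : ℝ) * h, ?_, ?_⟩
  · have hbox : ∀ S ∈ family, ((box S).card : ℝ) ≤ P ^ n * R ^ s := by
      intro S hS
      have hfac : ∀ j, (((if j ∈ S then Finset.Icc (-(N : ℤ)) N
          else Finset.Icc (-(M : ℤ)) M).card : ℕ) : ℝ) ≤ P * (if j ∈ S then R else 1) := by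
        intro j
        have hc : ∀ K : ℕ, (((Finset.Icc (-(K : ℤ)) K).card : ℕ) : ℝ) = 2 * (K : ℝ) + 1 := by
          intro K
          have : (Finset.Icc (-(K : ℤ)) K).card = 2 * K + 1 := by
            rw [Int.card_Icc]; omega
          rw [this]; push_cast; ring
        split_ifs
        · rw [hc]; exact hN
        · rw [hc, mul_one]; exact hM
      calc ((box S).card : ℝ) ≤ ∏ j : Fin n, P * (if j ∈ S then R else 1) := by
            rw [Fintype.card_piFinset]
            push_cast
            exact Finset.prod_le_prod (fun _ _ => by positivity) fun j _ => hfac j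
        _ = P ^ n * R ^ S.card := by
            rw [Finset.prod_mul_distrib, Finset.prod_ite_mem]
            simp
        _ ≤ P ^ n * R ^ s := by
            gcongr
            exact (Finset.mem_filter.1 hS).2
    calc (((family.biUnion box).image fun z j => (z j : ℝ) * h).card : ℝ)
        ≤ ((∑ S ∈ family, (box S).card : ℕ) : ℝ) := by
          exact_mod_cast Finset.card_image_le.trans Finset.card_biUnion_le
      _ ≤ family.card * (P ^ n * R ^ s) := by
          push_cast
          rw [← nsmul_eq_mul]
          exact Finset.sum_le_card_nsmul _ _ _ hbox
      _ ≤ 2 ^ n * (P ^ n * R ^ s) := by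
          have hcard : family.card ≤ 2 ^ n := (Finset.card_filter_le _ _).trans (by simp)
          have hcard' : (family.card : ℝ) ≤ 2 ^ n := by exact_mod_cast hcard
          gcongr
      _ = _ := by ring
  · intro x hxN hxM
    refine ⟨fun j => (⌊x j / h⌋ : ℝ) * h, ?_, ?_⟩
    · refine Finset.mem_image.2 ⟨fun j => ⌊x j / h⌋, Finset.mem_biUnion.2
        ⟨Finset.univ.filter fun j => M * h < |x j|, by simpa [family] using hxM, ?_⟩, rfl⟩
      have hfloor : ∀ (K : ℕ) (j : Fin n), |x j| ≤ K * h →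
          ⌊x j / h⌋ ∈ Finset.Icc (-(K : ℤ)) K := by
        intro K j hj
        have hj' := abs_le.1 hj
        have h1 : -(K : ℝ) ≤ x j / h := by rw [le_div_iff₀ hh]; linarith
        have h2 : x j / h ≤ K := by rw [div_le_iff₀ hh]; exact hj'.2
        refine Finset.mem_Icc.2 ⟨Int.le_floor.2 (by push_cast; exact h1), ?_⟩
        exact_mod_cast (Int.floor_le _).trans h2
      refine Fintype.mem_piFinset.2 fun j => ?_
      split_ifs with hj
      · exact hfloor N j (hxN j)
      · exact hfloor M j (not_lt.1 fun hlt => hj (by simpa using hlt))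
    · intro j
      have h1 := Int.floor_le (x j / h)
      have h2 := Int.lt_floor_add_one (x j / h)
      rw [le_div_iff₀ hh] at h1
      rw [div_lt_iff₀ hh] at h2
      rw [abs_le]
      constructor <;> nlinarith

theorem log_add_one_le_two_mul_log_sqrt_add_one (n : ℕ) :
    Real.log ((n : ℝ) + 1) ≤ 2 * Real.log ((Nat.sqrt n : ℝ) + 1) := by
  have h : (n : ℝ) + 1 ≤ ((Nat.sqrt n : ℝ) + 1) ^ 2 := by
    have := Nat.lt_succ_sqrt n
    rw [pow_two]
    exact_mod_cast this
  calc Real.log ((n : ℝ) + 1) ≤ Real.log (((Nat.sqrt n : ℝ) + 1) ^ 2) :=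
        Real.log_le_log (by positivity) h
    _ = _ := by rw [Real.log_pow]; norm_num

theorem two_mul_log_rpow_pow_sqrt_le {n : ℕ} (hn : 0 < n) {a : ℝ} (ha : 0 ≤ a) :
    ((2 * Real.log ((n : ℝ) + 1)) ^ a) ^ (Nat.sqrt n) ≤ Real.exp (4 * a) ^ n := by
  have hL := log_two_le_log_add_one hn
  have hpos : 0 < 2 * Real.log ((n : ℝ) + 1) := by linarith
  have h1 : Real.log (2 * Real.log ((n : ℝ) + 1)) ≤ 4 * Nat.sqrt n := by
    have h2 := Real.log_le_sub_one_of_pos hpos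
    have h3 := log_add_one_le_two_mul_log_sqrt_add_one n
    have h4 := Real.log_le_sub_one_of_pos (show (0 : ℝ) < (Nat.sqrt n : ℝ) + 1 by positivity)
    linarith
  have h5 : (Nat.sqrt n : ℝ) * Nat.sqrt n ≤ n := by exact_mod_cast Nat.sqrt_le n
  rw [Real.rpow_def_of_pos hpos, ← Real.exp_nat_mul, ← Real.exp_nat_mul, Real.exp_le_exp]
  calc (Nat.sqrt n : ℝ) * (Real.log (2 * Real.log ((n : ℝ) + 1)) * a)
      ≤ (Nat.sqrt n : ℝ) * (4 * Nat.sqrt n * a) := by gcongr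
    _ = (Nat.sqrt n * Nat.sqrt n) * (4 * a) := by ring
    _ ≤ n * (4 * a) := by gcongr

/-- The base of the exponential bound for sup-norm coverings of the ball of `ℓ_{∞,u}^n`,
where `a = 1/u`. -/
noncomputable def coverBase (a : ℝ) : ℝ := 2 * (7 * 2 ^ a) * Real.exp (4 * a)

theorem coverBase_pos (a : ℝ) : 0 < coverBase a := by
  unfold coverBase; positivity

/-- The ball of radius `r` in `ℓ_{∞,u}^n` is covered by `(C/δ)^n` cubes of radius
`δ r (log (n+1))^{-1/u}`. -/
theorem exists_sup_cover_lorentz {n : ℕ} {u : ℝ≥0∞} (hn : 0 < n) (hu : 0 < u) {δ r : ℝ}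
    (hδ : 0 < δ) (hδ1 : δ ≤ 1) (hr : 0 < r) :
    ∃ T : Finset (Fin n → ℝ), (T.card : ℝ) ≤ (coverBase (1 / u).toReal / δ) ^ n ∧
      ∀ x : Fin n → ℝ, lorentzNorm n ⊤ u x ≤ r →
        ∃ y ∈ T, ∀ j, |x j - y j| ≤ δ * r / Real.log ((n : ℝ) + 1) ^ (1 / u).toReal := by
  set a := (1 / u).toReal
  have ha : 0 ≤ a := ENNReal.toReal_nonneg
  set L := Real.log ((n : ℝ) + 1)
  have hL : 1 / 2 ≤ L := log_two_le_log_add_one hn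
  have hLa : 0 < L ^ a := Real.rpow_pos_of_pos (by linarith) a
  have h2a : (1 : ℝ) ≤ 2 ^ a := Real.one_le_rpow (by norm_num) ha
  have hR : 1 ≤ (2 * L) ^ a := Real.one_le_rpow (by linarith) ha
  have hRe : (2 * L) ^ a = 2 ^ a * L ^ a := Real.mul_rpow (by norm_num) (by linarith)
  have hceil1 := (Nat.ceil_lt_add_one (show 0 ≤ 2 * 2 ^ a / δ by positivity)).le
  have hceil2 := (Nat.ceil_lt_add_one (show 0 ≤ 2 * L ^ a / δ by positivity)).le
  have hM : 2 * ((⌈2 * 2 ^ a / δ⌉₊ : ℕ) : ℝ) + 1 ≤ 7 * 2 ^ a / δ := by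
    have h3 : 1 ≤ 2 ^ a / δ := by rw [le_div_iff₀ hδ]; linarith
    have e1 : 2 * (2 : ℝ) ^ a / δ = 2 * (2 ^ a / δ) := by ring
    have e2 : 7 * (2 : ℝ) ^ a / δ = 7 * (2 ^ a / δ) := by ring
    rw [e1] at hceil1 ⊢
    rw [e2]
    linarith
  have hN : 2 * ((⌈2 * L ^ a / δ⌉₊ : ℕ) : ℝ) + 1 ≤ 7 * 2 ^ a / δ * (2 * L) ^ a := by
    have h3 : 1 ≤ (2 * L) ^ a / δ := by rw [le_div_iff₀ hδ]; linarith
    have h4 : L ^ a / δ ≤ (2 * L) ^ a / δ := by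
      gcongr
      linarith
    have h5 : (2 * L) ^ a / δ ≤ 2 ^ a * ((2 * L) ^ a / δ) := by nlinarith
    have e1 : 2 * L ^ a / δ = 2 * (L ^ a / δ) := by ring
    have e2 : 7 * 2 ^ a / δ * (2 * L) ^ a = 7 * (2 ^ a * ((2 * L) ^ a / δ)) := by ring
    rw [e1] at hceil2 ⊢
    rw [e2]
    linarith
  obtain ⟨T, hT, hcov⟩ := exists_grid_cover n (Nat.sqrt n) _ _
    (show 0 < δ * r / L ^ a by positivity) hR hM hN
  refine ⟨T, hT.trans ?_, fun x hx => hcov x ?_ ?_⟩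
  · calc 2 ^ n * (7 * 2 ^ a / δ) ^ n * ((2 * L) ^ a) ^ Nat.sqrt n
        ≤ 2 ^ n * (7 * 2 ^ a / δ) ^ n * Real.exp (4 * a) ^ n := by
          have := two_mul_log_rpow_pow_sqrt_le hn ha
          gcongr
      _ = _ := by
          rw [← mul_pow, ← mul_pow, coverBase]
          congr 1
          ring
  · have h1 := (rearr_mul_harmonic_rpow_le hu one_pos hn x).trans hx
    rw [show (harmonic 1 : ℝ) = 1 by simp [harmonic], Real.one_rpow, mul_one] at h1
    intro j
    refine (abs_le_of_rearr_one_lt (show rearr n x 1 < 2 * r by linarith) j).trans ?_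
    calc 2 * r = (2 * L ^ a / δ) * (δ * r / L ^ a) := by field_simp
      _ ≤ _ := by
        gcongr
        exact Nat.le_ceil _
  · have hs : 0 < Nat.sqrt n := Nat.sqrt_pos.2 hn
    have h1 := (rearr_mul_harmonic_rpow_le hu hs (Nat.sqrt_le_self n) x).trans hx
    have hH : L / 2 ≤ (harmonic (Nat.sqrt n) : ℝ) := by
      have := log_add_one_le_two_mul_log_sqrt_add_one n
      have := log_add_one_le_harmonic_cast (Nat.sqrt n)
      linarith
    have h2 : rearr n x (Nat.sqrt n) * (L / 2) ^ a ≤ r := by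
      refine le_trans ?_ h1
      exact mul_le_mul_of_nonneg_left (Real.rpow_le_rpow (by linarith) hH ha)
        (rearr_nonneg n x _)
    rw [Real.div_rpow (by linarith) (by norm_num), ← mul_div_assoc,
      div_le_iff₀ (by positivity), ← le_div_iff₀ hLa] at h2
    refine (card_lt_abs_le_of_rearr_lt (h2.trans_lt ?_)).trans (Nat.sub_le _ _)
    calc r * 2 ^ a / L ^ a < 2 * (r * 2 ^ a / L ^ a) := by
          have : 0 < r * 2 ^ a / L ^ a := by positivity
          linarith
      _ = (2 * 2 ^ a / δ) * (δ * r / L ^ a) := by field_simp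
      _ ≤ _ := by
        gcongr
        exact Nat.le_ceil _

/-- Comparison of volumes for a cube covered by finitely many smaller cubes. -/
theorem pow_le_card_mul_pow_of_cube_cover {n : ℕ} {ρ η : ℝ} (hρ : 0 ≤ ρ) (hη : 0 ≤ η)
    (T : Finset (Fin n → ℝ))
    (h : ∀ x : Fin n → ℝ, (∀ j, |x j| ≤ ρ) → ∃ y ∈ T, ∀ j, |x j - y j| ≤ η) :
    ρ ^ n ≤ T.card * η ^ n := by
  have hsub : Metric.closedBall (0 : Fin n → ℝ) ρ ⊆ ⋃ y ∈ T, Metric.closedBall y η := by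
    intro x hx
    rw [mem_closedBall_zero_iff, pi_norm_le_iff_of_nonneg hρ] at hx
    obtain ⟨y, hy, hxy⟩ := h x hx
    exact Set.mem_biUnion hy ((dist_pi_le_iff hη).2 hxy)
  have hvol : volume (Metric.closedBall (0 : Fin n → ℝ) ρ) ≤
      ∑ y ∈ T, volume (Metric.closedBall y η) :=
    (measure_mono hsub).trans (measure_biUnion_finset_le _ _)
  simp only [Real.volume_pi_closedBall _ hρ, Real.volume_pi_closedBall _ hη, Fintype.card_fin,
    Finset.sum_const, nsmul_eq_mul] at hvol
  rw [← ENNReal.ofReal_natCast, ← ENNReal.ofReal_mul (by positivity),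
    ENNReal.ofReal_le_ofReal_iff (by positivity), mul_pow, mul_pow, mul_left_comm] at hvol
  exact le_of_mul_le_mul_left hvol (by positivity)

/-- An admissible radius in the definition of the entropy numbers. -/
theorem exists_lorentz_cover_of_two_rpow {u v : ℝ≥0∞} (hv : 0 < v) (hvu : v ≤ u) {n k : ℕ}
    (hn : 0 < n) (hk : 0 < k) :
    ∃ T : Finset (Fin n → ℝ), T.card ≤ 2 ^ (k - 1) ∧
      ∀ x : Fin n → ℝ, lorentzNorm n ⊤ u x ≤ 1 → ∃ y ∈ T, lorentzNorm n ⊤ v (x - y) ≤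
        2 * coverBase (1 / u).toReal * 3 ^ (1 / v).toReal * ((2 : ℝ) ^ (-(k : ℝ) / (n : ℝ)) *
          Real.log ((n : ℝ) + 1) ^ ((1 / v).toReal - (1 / u).toReal)) := by
  have hab := toReal_one_div_le_one_div hv hvu
  have ha : 0 ≤ (1 / u).toReal := ENNReal.toReal_nonneg
  have hL := log_two_le_log_add_one hn
  have hH := harmonic_le_three_mul_log hn
  have hH0 : (0 : ℝ) < harmonic n := by exact_mod_cast harmonic_pos hn.ne'
  have hD := coverBase_pos (1 / u).toReal
  have hn' : (1 : ℝ) ≤ n := by exact_mod_cast hn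
  set a := (1 / u).toReal
  set b := (1 / v).toReal
  set L := Real.log ((n : ℝ) + 1)
  have hLpos : 0 < L := by linarith
  set δ := coverBase a * 2 ^ (-((k - 1 : ℕ) : ℝ) / n) with hδ_def
  have hδ : 0 < δ := by positivity
  have hδle : δ ≤ 2 * coverBase a * 2 ^ (-(k : ℝ) / n) := by
    have : (2 : ℝ) ^ (-((k - 1 : ℕ) : ℝ) / n) ≤ 2 * 2 ^ (-(k : ℝ) / n) := by
      calc (2 : ℝ) ^ (-((k - 1 : ℕ) : ℝ) / n) ≤ 2 ^ (1 + -(k : ℝ) / n) := by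
            apply Real.rpow_le_rpow_of_exponent_le (by norm_num)
            rw [Nat.cast_sub hk, Nat.cast_one]
            rw [div_le_iff₀ (by linarith), add_mul, div_mul_cancel₀ _ (by linarith)]
            linarith
        _ = _ := by rw [Real.rpow_add (by norm_num), Real.rpow_one]
    calc δ ≤ coverBase a * (2 * 2 ^ (-(k : ℝ) / n)) :=
          mul_le_mul_of_nonneg_left this hD.le
      _ = _ := by ring
  have htarget : δ * 3 ^ b * L ^ (b - a) ≤
      2 * coverBase a * 3 ^ b * ((2 : ℝ) ^ (-(k : ℝ) / (n : ℝ)) * L ^ (b - a)) := by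
    calc δ * 3 ^ b * L ^ (b - a)
        ≤ (2 * coverBase a * 2 ^ (-(k : ℝ) / n)) * 3 ^ b * L ^ (b - a) := by gcongr
      _ = _ := by ring
  rcases le_or_gt δ 1 with hδ1 | hδ1
  · obtain ⟨T, hT, hcov⟩ := exists_sup_cover_lorentz hn (hv.trans_le hvu) hδ hδ1 one_pos
    refine ⟨T, ?_, fun x hx => ?_⟩
    · have hpow : (coverBase a / δ) ^ n = (2 : ℝ) ^ (k - 1) := by
        have : coverBase a / δ = 2 ^ (((k - 1 : ℕ) : ℝ) / n) := by
          rw [hδ_def, neg_div, Real.rpow_neg (by norm_num)]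
          field_simp
        rw [this, ← Real.rpow_natCast, ← Real.rpow_mul (by norm_num),
          div_mul_cancel₀ _ (by linarith), Real.rpow_natCast]
      have := hT.trans_eq hpow
      exact_mod_cast this
    · obtain ⟨y, hy, hxy⟩ := hcov x hx
      refine ⟨y, hy, le_trans ?_ htarget⟩
      calc lorentzNorm n ⊤ v (x - y) ≤ δ * 1 / L ^ a * (harmonic n : ℝ) ^ b :=
            lorentzNorm_top_le_of_forall_le hn hv (by positivity) hxy
        _ ≤ δ * 1 / L ^ a * (3 * L) ^ b := by gcongr
        _ = _ := by
            rw [Real.mul_rpow (by norm_num) hLpos.le, Real.rpow_sub hLpos]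
            ring
  · refine ⟨{0}, by simpa using Nat.one_le_two_pow, fun x hx => ⟨0, by simp, ?_⟩⟩
    rw [sub_zero]
    refine le_trans ?_ htarget
    calc lorentzNorm n ⊤ v x ≤ (harmonic n : ℝ) ^ (b - a) :=
          lorentzNorm_top_le_harmonic_rpow hn hv hvu hx
      _ ≤ (3 * L) ^ (b - a) := Real.rpow_le_rpow hH0.le hH (by linarith)
      _ = 3 ^ (b - a) * L ^ (b - a) := Real.mul_rpow (by norm_num) hLpos.le
      _ ≤ 3 ^ b * L ^ (b - a) := by
          gcongr
          · norm_num
          · exact sub_le_self b ha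
      _ ≤ δ * (3 ^ b * L ^ (b - a)) := le_mul_of_one_le_left (by positivity) hδ1.le
      _ = _ := by ring

/-- A lower bound for every admissible radius in the definition of the entropy numbers. -/
theorem le_radius_of_lorentz_cover {u v : ℝ≥0∞} (hu : 0 < u) (hv : 0 < v) {n k : ℕ}
    (hn : 0 < n) {ε : ℝ} (hε : 0 < ε) {T : Finset (Fin n → ℝ)} (hT : T.card ≤ 2 ^ (k - 1))
    (hcov : ∀ x : Fin n → ℝ, lorentzNorm n ⊤ u x ≤ 1 →
      ∃ y ∈ T, lorentzNorm n ⊤ v (x - y) ≤ ε) :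
    (3 ^ (1 / u).toReal * coverBase (1 / v).toReal)⁻¹ * ((2 : ℝ) ^ (-(k : ℝ) / (n : ℝ)) *
      Real.log ((n : ℝ) + 1) ^ ((1 / v).toReal - (1 / u).toReal)) ≤ ε := by
  have ha : 0 ≤ (1 / u).toReal := ENNReal.toReal_nonneg
  have hL := log_two_le_log_add_one hn
  have hH := harmonic_le_three_mul_log hn
  have hH0 : (0 : ℝ) < harmonic n := by exact_mod_cast harmonic_pos hn.ne'
  have hD := coverBase_pos (1 / v).toReal
  have hn' : (1 : ℝ) ≤ n := by exact_mod_cast hn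
  obtain ⟨T', hT', hcov'⟩ := exists_sup_cover_lorentz hn hv one_pos le_rfl hε
  set a := (1 / u).toReal
  set b := (1 / v).toReal
  set L := Real.log ((n : ℝ) + 1)
  have hLpos : 0 < L := by linarith
  have hvol : (((3 * L) ^ a)⁻¹) ^ n ≤
      ((T ×ˢ T').image fun p => p.1 + p.2).card * (1 * ε / L ^ b) ^ n := by
    refine pow_le_card_mul_pow_of_cube_cover (by positivity) (by positivity) _ fun x hx => ?_
    have hx1 : lorentzNorm n ⊤ u x ≤ 1 := by
      refine (lorentzNorm_top_le_of_forall_le hn hu (by positivity) hx).trans ?_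
      rw [inv_mul_le_one₀ (by positivity)]
      exact Real.rpow_le_rpow hH0.le hH ha
    obtain ⟨y, hy, hxy⟩ := hcov x hx1
    obtain ⟨y', hy', hxy'⟩ := hcov' _ hxy
    refine ⟨y + y', Finset.mem_image.2 ⟨(y, y'), Finset.mem_product.2 ⟨hy, hy'⟩, rfl⟩, ?_⟩
    intro j
    simpa [sub_sub] using hxy' j
  have hcard : (((T ×ˢ T').image fun p => p.1 + p.2).card : ℝ) ≤
      ((2 : ℝ) ^ ((k : ℝ) / n) * coverBase b) ^ n := by
    calc (((T ×ˢ T').image fun p => p.1 + p.2).card : ℝ) ≤ T.card * T'.card := by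
          rw [← Nat.cast_mul, ← Finset.card_product]
          exact_mod_cast Finset.card_image_le
      _ ≤ 2 ^ k * coverBase b ^ n := by
          rw [div_one] at hT'
          have : T.card ≤ 2 ^ k := hT.trans (Nat.pow_le_pow_right (by norm_num) (Nat.sub_le k 1))
          have : (T.card : ℝ) ≤ 2 ^ k := by exact_mod_cast this
          gcongr
      _ = _ := by
          rw [mul_pow, ← Real.rpow_natCast (2 ^ ((k : ℝ) / n)), ← Real.rpow_mul (by norm_num),
            div_mul_cancel₀ _ (by linarith), Real.rpow_natCast]
  have hroot : ((3 * L) ^ a)⁻¹ ≤ 2 ^ ((k : ℝ) / n) * coverBase b * (1 * ε / L ^ b) := by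
    refine le_of_pow_le_pow_left₀ hn.ne' (by positivity) (hvol.trans ?_)
    rw [mul_pow _ (1 * ε / L ^ b)]
    gcongr
  rw [Real.mul_rpow (by norm_num) hLpos.le] at hroot
  rw [neg_div, Real.rpow_neg (by norm_num), Real.rpow_sub hLpos]
  have h2 : (0 : ℝ) < 2 ^ ((k : ℝ) / n) := by positivity
  have hLb : 0 < L ^ b := by positivity
  calc (3 ^ a * coverBase b)⁻¹ * (((2 : ℝ) ^ ((k : ℝ) / n))⁻¹ * (L ^ b / L ^ a))
      = (3 ^ a * L ^ a)⁻¹ * (L ^ b / (2 ^ ((k : ℝ) / n) * coverBase b)) := by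
        field_simp
    _ ≤ (2 ^ ((k : ℝ) / n) * coverBase b * (1 * ε / L ^ b)) *
          (L ^ b / (2 ^ ((k : ℝ) / n) * coverBase b)) := by gcongr
    _ = ε := by field_simp

/-- Case (IV.1) of the main theorem: for `p = q = ∞` and `0 < v ≤ u ≤ ∞`,
`e_k(id : ℓ_{∞,u}^n → ℓ_{∞,v}^n) ≍ 2^{-k/n} (log(n+1))^{1/v - 1/u}` uniformly in
`k` and `n`. -/
theorem entropy_lorentz_inftyu_inftyv_of_ge
    (u v : ℝ≥0∞) (hv : 0 < v) (hvu : v ≤ u) :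
    ∃ c C : ℝ, 0 < c ∧ 0 < C ∧ ∀ n k : ℕ, 0 < n → 0 < k →
      c * ((2 : ℝ) ^ (-(k : ℝ) / (n : ℝ)) *
            Real.log ((n : ℝ) + 1) ^ ((1 / v).toReal - (1 / u).toReal)) ≤
          entropyNumber n (lorentzNorm n ⊤ u) (lorentzNorm n ⊤ v) k ∧
        entropyNumber n (lorentzNorm n ⊤ u) (lorentzNorm n ⊤ v) k ≤
          C * ((2 : ℝ) ^ (-(k : ℝ) / (n : ℝ)) *
            Real.log ((n : ℝ) + 1) ^ ((1 / v).toReal - (1 / u).toReal)) := by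
  have hD := coverBase_pos (1 / u).toReal
  have hD' := coverBase_pos (1 / v).toReal
  refine ⟨(3 ^ (1 / u).toReal * coverBase (1 / v).toReal)⁻¹,
    2 * coverBase (1 / u).toReal * 3 ^ (1 / v).toReal, by positivity, by positivity,
    fun n k hn hk => ?_⟩
  have hL : 0 < Real.log ((n : ℝ) + 1) := by linarith [log_two_le_log_add_one hn]
  have hmem := exists_lorentz_cover_of_two_rpow hv hvu hn hk
  constructor
  · refine le_csInf ⟨_, by positivity, hmem⟩ ?_
    rintro ε ⟨hε, T, hT, hcov⟩
    exact le_radius_of_lorentz_cover (hv.trans_le hvu) hv hn hε hT hcov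
  · exact csInf_le ⟨0, fun ε hε => hε.1.le⟩ ⟨by positivity, hmem⟩
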